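/- For Δ ∈ [0,1) define the density f_{dif,Δ}(r) = (2/(1−Δ)) · max{ 1 − r/(1−Δ), 0 } for r ∈ [0,1] (so f_{dif,0}(r) = 2(1−r)). Let h : [0,1] → ℝ be nonincreasing and Lipschitz continuous. Then: (i) for all 0 ≤ Δ ≤ Δ' < 1, ∫_0^1 e^{−h(r)} f_{dif,Δ'}(r) dr ≤ ∫_0^1 e^{−h(r)} f_{dif,Δ}(r) dr; and (ii) consequently, defining L̄(h, Δ') = ∫_0^1 h(r) f_{dif,0}(r) dr + log ∫_0^1 e^{−h(r)} f_{dif,Δ'}(r) dr, one has sup_{Δ' ∈ [Δ, 1)} L̄(h, Δ') = L̄(h, Δ) for every Δ ∈ [0,1). -/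

import Mathlib

/-- The limiting density `f_{dif,Δ}(r) = (2/(1-Δ)) · max{1 - r/(1-Δ), 0}` of the
inverse-transform watermark statistic under the alternative. -/
noncomputable def fdif (Δ r : ℝ) : ℝ := (2 / (1 - Δ)) * max (1 - r / (1 - Δ)) 0

theorem continuous_fdif (Δ : ℝ) : Continuous (fdif Δ) := by
  unfold fdif
  fun_prop

/-- Rescaling by `1 - Δ` turns integration against `fdif Δ` into integration against the
triangular density `2 * (1 - s)`. -/
theorem integral_mul_fdif {g : ℝ → ℝ} (hg : ContinuousOn g (Set.Icc 0 1)) {Δ : ℝ}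
    (h0 : 0 ≤ Δ) (h1 : Δ < 1) :
    ∫ r in (0:ℝ)..1, g r * fdif Δ r
      = ∫ s in (0:ℝ)..1, g ((1 - Δ) * s) * (2 * (1 - s)) := by
  have hc : 0 < 1 - Δ := by linarith
  have hcont : ContinuousOn (fun r => g r * fdif Δ r) (Set.Icc 0 1) :=
    hg.mul (continuous_fdif Δ).continuousOn
  have hint_left : IntervalIntegrable (fun r => g r * fdif Δ r) MeasureTheory.volume 0 (1 - Δ) :=
    (hcont.mono (Set.Icc_subset_Icc le_rfl (by linarith))).intervalIntegrable_of_Icc hc.le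
  have hint_right : IntervalIntegrable (fun r => g r * fdif Δ r) MeasureTheory.volume (1 - Δ) 1 :=
    (hcont.mono (Set.Icc_subset_Icc hc.le le_rfl)).intervalIntegrable_of_Icc (by linarith)
  have hzero : ∫ r in (1 - Δ)..1, g r * fdif Δ r = 0 := by
    rw [intervalIntegral.integral_congr (g := fun _ => (0 : ℝ))]
    · simp
    · intro r hr
      rw [Set.uIcc_of_le (by linarith)] at hr
      have : 1 ≤ r / (1 - Δ) := (one_le_div hc).2 hr.1
      simp [fdif, max_eq_right (sub_nonpos.2 this)]
  rw [← intervalIntegral.integral_add_adjacent_intervals hint_left hint_right, hzero, add_zero]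
  have hscale := intervalIntegral.mul_integral_comp_mul_left (a := 0) (b := 1)
    (f := fun r => g r * fdif Δ r) (1 - Δ)
  rw [mul_zero, mul_one] at hscale
  rw [← hscale, ← intervalIntegral.integral_const_mul]
  refine intervalIntegral.integral_congr fun s hs => ?_
  rw [Set.uIcc_of_le zero_le_one] at hs
  simp only [fdif]
  rw [mul_div_cancel_left₀ _ hc.ne', max_eq_left (sub_nonneg.2 hs.2)]
  field_simp

theorem mul_mem_Icc_zero_one {c s : ℝ} (hc : c ∈ Set.Icc (0:ℝ) 1) (hs : s ∈ Set.Icc (0:ℝ) 1) :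
    c * s ∈ Set.Icc (0:ℝ) 1 :=
  ⟨mul_nonneg hc.1 hs.1, mul_le_one₀ hc.2 hs.1 hs.2⟩

theorem intervalIntegrable_comp_mul_triangular {g : ℝ → ℝ} (hg : ContinuousOn g (Set.Icc 0 1))
    {c : ℝ} (hc : c ∈ Set.Icc (0:ℝ) 1) :
    IntervalIntegrable (fun s => g (c * s) * (2 * (1 - s))) MeasureTheory.volume 0 1 := by
  refine ContinuousOn.intervalIntegrable_of_Icc zero_le_one (ContinuousOn.mul ?_ (by fun_prop))
  exact hg.comp (by fun_prop) fun s hs => mul_mem_Icc_zero_one hc hs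

theorem integral_mul_fdif_antitone {g : ℝ → ℝ} (hg : ContinuousOn g (Set.Icc 0 1))
    (hmono : MonotoneOn g (Set.Icc 0 1)) {Δ Δ' : ℝ} (h0 : 0 ≤ Δ) (hle : Δ ≤ Δ') (h1 : Δ' < 1) :
    ∫ r in (0:ℝ)..1, g r * fdif Δ' r ≤ ∫ r in (0:ℝ)..1, g r * fdif Δ r := by
  have hc : 1 - Δ ∈ Set.Icc (0:ℝ) 1 := ⟨by linarith, by linarith⟩
  have hc' : 1 - Δ' ∈ Set.Icc (0:ℝ) 1 := ⟨by linarith, by linarith⟩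
  rw [integral_mul_fdif hg (h0.trans hle) h1, integral_mul_fdif hg h0 (hle.trans_lt h1)]
  refine intervalIntegral.integral_mono_on zero_le_one
    (intervalIntegrable_comp_mul_triangular hg hc')
    (intervalIntegrable_comp_mul_triangular hg hc) fun s hs => ?_
  exact mul_le_mul_of_nonneg_right
    (hmono (mul_mem_Icc_zero_one hc' hs) (mul_mem_Icc_zero_one hc hs)
      (mul_le_mul_of_nonneg_right (by linarith) hs.1))
    (by linarith [hs.2])

theorem integral_mul_fdif_pos {g : ℝ → ℝ} (hg : ContinuousOn g (Set.Icc 0 1))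
    (hpos : ∀ r, 0 < g r) {Δ : ℝ} (h0 : 0 ≤ Δ) (h1 : Δ < 1) :
    0 < ∫ r in (0:ℝ)..1, g r * fdif Δ r := by
  rw [integral_mul_fdif hg h0 h1]
  exact intervalIntegral.intervalIntegral_pos_of_pos_on
    (intervalIntegrable_comp_mul_triangular hg ⟨by linarith, by linarith⟩)
    (fun s hs => mul_pos (hpos _) (by linarith [hs.2])) zero_lt_one

/-- Monotonicity of the limiting objective for the inverse-transform watermark:
for nonincreasing Lipschitz `h` on `[0,1]`, `Δ' ↦ ∫ e^{-h} f_{dif,Δ'}` is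
nonincreasing, and hence `sup_{Δ' ∈ [Δ,1)} L̄(h,Δ') = L̄(h,Δ)`. -/
theorem inverse_transform_objective_monotone
    (h : ℝ → ℝ) (hanti : AntitoneOn h (Set.Icc 0 1))
    (K : NNReal) (hlip : LipschitzOnWith K h (Set.Icc 0 1)) :
    (∀ Δ Δ' : ℝ, 0 ≤ Δ → Δ ≤ Δ' → Δ' < 1 →
      ∫ r in (0:ℝ)..1, Real.exp (-h r) * fdif Δ' r
        ≤ ∫ r in (0:ℝ)..1, Real.exp (-h r) * fdif Δ r)
    ∧ (∀ Δ : ℝ, 0 ≤ Δ → Δ < 1 →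
        sSup ((fun Δ' : ℝ =>
            (∫ r in (0:ℝ)..1, h r * fdif 0 r)
              + Real.log (∫ r in (0:ℝ)..1, Real.exp (-h r) * fdif Δ' r)) ''
          Set.Ico Δ 1)
          = (∫ r in (0:ℝ)..1, h r * fdif 0 r)
            + Real.log (∫ r in (0:ℝ)..1, Real.exp (-h r) * fdif Δ r)) := by
  have hg : ContinuousOn (fun r => Real.exp (-h r)) (Set.Icc 0 1) :=
    hlip.continuousOn.neg.rexp
  have hmono : MonotoneOn (fun r => Real.exp (-h r)) (Set.Icc 0 1) := fun x hx y hy hxy =>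
    Real.exp_le_exp.2 (neg_le_neg (hanti hx hy hxy))
  refine ⟨fun Δ Δ' h0 hle h1 => integral_mul_fdif_antitone hg hmono h0 hle h1,
    fun Δ h0 h1 => IsGreatest.csSup_eq ⟨⟨Δ, ⟨le_rfl, h1⟩, rfl⟩, ?_⟩⟩
  rintro _ ⟨Δ', hΔ', rfl⟩
  exact add_le_add_right (Real.log_le_log
    (integral_mul_fdif_pos hg (fun _ => Real.exp_pos _) (h0.trans hΔ'.1) hΔ'.2)
    (integral_mul_fdif_antitone hg hmono h0 hΔ'.1 hΔ'.2)) _
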